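/- Let μ ∈ ℝ be irrational and let θ, ν ∈ ℝ. Set A_j = μj + θ for j ∈ ℤ. Then σ(L_A) = σ(H_{μ,ν}), i.e., the spectrum of the weighted discrete operator L_A coincides with the spectrum of the critical almost Mathieu operator with frequency μ. -/

import Mathlib

open Real

/-- The Hilbert space `ℓ²(ℤ; ℂ)`. -/
abbrev EllTwo : Type := lp (fun _ : ℤ => ℂ) 2

/-- The formal Jacobi operator with off-diagonal coefficients `a` and diagonal coefficients `b`. -/
def jacobi (a b φ : ℤ → ℂ) (j : ℤ) : ℂ :=
  a j * φ (j + 1) + a (j - 1) * φ (j - 1) + b j * φ j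

lemma norm_jacobi_le {a b φ : ℤ → ℂ} {M B : ℝ} (ha : ∀ j, ‖a j‖ ≤ M) (hb : ∀ j, ‖b j‖ ≤ M)
    (hφ : ∀ j, ‖φ j‖ ≤ B) (j : ℤ) : ‖jacobi a b φ j‖ ≤ 3 * (M * B) := by
  have hM : 0 ≤ M := (norm_nonneg _).trans (ha 0)
  have h1 : ‖a j * φ (j + 1)‖ ≤ M * B := by
    rw [norm_mul]; exact mul_le_mul (ha _) (hφ _) (norm_nonneg _) hM
  have h2 : ‖a (j - 1) * φ (j - 1)‖ ≤ M * B := by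
    rw [norm_mul]; exact mul_le_mul (ha _) (hφ _) (norm_nonneg _) hM
  have h3 : ‖b j * φ j‖ ≤ M * B := by
    rw [norm_mul]; exact mul_le_mul (hb _) (hφ _) (norm_nonneg _) hM
  have := norm_add₃_le (a := a j * φ (j + 1)) (b := a (j - 1) * φ (j - 1)) (c := b j * φ j)
  unfold jacobi
  linarith

/-- A formal Jacobi operator is symmetric for the bilinear pairing with finite sequences. -/
lemma tsum_mul_jacobi (a b K u : ℤ → ℂ) (hu : u.support.Finite) :
    ∑' n, K n * jacobi a b u n = ∑' n, jacobi a b K n * u n := by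
  have hfin (f : ℤ → ℂ) : Summable fun n => f n * u n :=
    summable_of_hasFiniteSupport (hu.subset (Function.support_mul_subset_right _ _))
  have hup (f : ℤ → ℂ) : Summable fun n => f n * u (n + 1) := by
    simpa [Function.comp_def] using
      (Equiv.addRight (1 : ℤ)).summable_iff.2 (hfin fun n => f (n - 1))
  have hdown (f : ℤ → ℂ) : Summable fun n => f n * u (n - 1) := by
    simpa [Function.comp_def, sub_eq_add_neg] using
      (Equiv.addRight (-1 : ℤ)).summable_iff.2 (hfin fun n => f (n + 1))
  have eup (f : ℤ → ℂ) : ∑' n, f n * u (n + 1) = ∑' n, f (n - 1) * u n := by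
    simpa using (Equiv.addRight (1 : ℤ)).tsum_eq (fun n => f (n - 1) * u n)
  have edown (f : ℤ → ℂ) : ∑' n, f n * u (n - 1) = ∑' n, f (n + 1) * u n := by
    simpa [sub_eq_add_neg] using (Equiv.addRight (-1 : ℤ)).tsum_eq (fun n => f (n + 1) * u n)
  calc ∑' n, K n * jacobi a b u n
      = ∑' n, (K n * a n * u (n + 1) + K n * a (n - 1) * u (n - 1) + K n * b n * u n) := by
        congr 1 with n; unfold jacobi; ring
    _ = ∑' n, K (n - 1) * a (n - 1) * u n + ∑' n, K (n + 1) * a n * u n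
          + ∑' n, K n * b n * u n := by
        rw [((hup fun n => K n * a n).add (hdown fun n => K n * a (n - 1))).tsum_add
            (hfin fun n => K n * b n),
          (hup fun n => K n * a n).tsum_add (hdown fun n => K n * a (n - 1)),
          eup fun n => K n * a n, edown fun n => K n * a (n - 1)]
        simp
    _ = ∑' n, jacobi a b K n * u n := by
        rw [← (hfin fun n => K (n - 1) * a (n - 1)).tsum_add (hfin fun n => K (n + 1) * a n),
          ← ((hfin fun n => K (n - 1) * a (n - 1)).add (hfin fun n => K (n + 1) * a n)).tsum_add
            (hfin fun n => K n * b n)]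
        congr 1 with n; unfold jacobi; ring

lemma support_jacobi_finite (a b u : ℤ → ℂ) (hu : u.support.Finite) :
    (jacobi a b u).support.Finite := by
  have h1 : (Function.support fun n => u (n + 1)).Finite :=
    hu.preimage (f := fun n : ℤ => n + 1) (add_left_injective _).injOn
  have h2 : (Function.support fun n => u (n - 1)).Finite :=
    hu.preimage (f := fun n : ℤ => n - 1) sub_left_injective.injOn
  refine ((h1.union h2).union hu).subset fun n hn => ?_
  by_contra h
  simp only [Set.mem_union, Function.mem_support, not_or, not_not] at h
  exact hn (by simp [jacobi, h.1.1, h.1.2, h.2])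

lemma EllTwo.norm_sq_eq_sum (f : EllTwo) (s : Finset ℤ) (hf : ∀ j ∉ s, f j = 0) :
    ‖f‖ ^ 2 = ∑ j ∈ s, ‖f j‖ ^ 2 := by
  have h := lp.norm_rpow_eq_tsum (p := 2) (by norm_num) f
  simp only [ENNReal.toReal_ofNat, Real.rpow_ofNat] at h
  rw [h, tsum_eq_sum]
  intro j hj
  simp [hf j hj]

/-- If a bounded Jacobi operator is bounded below, then so is the formal operator on bounded
sequences in the sense of averages over long intervals, up to boundary terms. -/
lemma sum_jacobi_lower_bound {a b : ℤ → ℂ} {M B c : ℝ} (ha : ∀ j, ‖a j‖ ≤ M)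
    (hb : ∀ j, ‖b j‖ ≤ M) {T : EllTwo →L[ℂ] EllTwo} (hT : ∀ φ j, T φ j = jacobi a b φ j)
    (hc : 0 ≤ c) (hTc : ∀ φ, c * ‖φ‖ ≤ ‖T φ‖) {Φ : ℤ → ℂ} (hΦ : ∀ j, ‖Φ j‖ ≤ B) (N : ℕ) :
    c ^ 2 * ∑ j ∈ Finset.Ico (0 : ℤ) N, ‖Φ j‖ ^ 2 ≤
      ∑ j ∈ Finset.Ico (0 : ℤ) N, ‖jacobi a b Φ j‖ ^ 2 + 4 * (3 * (M * B)) ^ 2 := by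
  have hB : 0 ≤ B := (norm_nonneg _).trans (hΦ 0)
  set I := Finset.Ico (0 : ℤ) N with hI
  set E : Finset ℤ := {-1, 0, (N : ℤ) - 1, (N : ℤ)} with hE
  set φ : EllTwo := ∑ i ∈ I, lp.single 2 i (Φ i) with hφ
  have hφv (j : ℤ) : φ j = if j ∈ I then Φ j else 0 := by
    simp only [hφ, lp.coeFn_sum, Finset.sum_apply, lp.coeFn_single, Finset.sum_pi_single]
  have hφB (j : ℤ) : ‖φ j‖ ≤ B := by
    rw [hφv]; split_ifs
    · exact hΦ j
    · simpa using hB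
  have key (j : ℤ) : ‖jacobi a b φ j‖ ^ 2 ≤
      (if j ∈ I then ‖jacobi a b Φ j‖ ^ 2 else 0) + (if j ∈ E then (3 * (M * B)) ^ 2 else 0) := by
    by_cases hjE : j ∈ E
    · have h1 := norm_jacobi_le ha hb hφB j
      have h2 : ‖jacobi a b φ j‖ ^ 2 ≤ (3 * (M * B)) ^ 2 :=
        pow_le_pow_left₀ (norm_nonneg _) h1 2
      rw [if_pos hjE]
      split_ifs <;> nlinarith [sq_nonneg ‖jacobi a b Φ j‖]
    · rw [if_neg hjE, add_zero]
      simp only [hE, Finset.mem_insert, Finset.mem_singleton, not_or] at hjE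
      by_cases hjI : j ∈ I
      · rw [if_pos hjI]
        rw [hI, Finset.mem_Ico] at hjI
        have h1 : j + 1 ∈ I := by rw [hI, Finset.mem_Ico]; lia
        have h2 : j - 1 ∈ I := by rw [hI, Finset.mem_Ico]; lia
        have h3 : j ∈ I := by rw [hI, Finset.mem_Ico]; lia
        simp [jacobi, hφv, h1, h2, h3]
      · rw [if_neg hjI]
        rw [hI, Finset.mem_Ico] at hjI
        have h1 : j + 1 ∉ I := by rw [hI, Finset.mem_Ico]; lia
        have h2 : j - 1 ∉ I := by rw [hI, Finset.mem_Ico]; lia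
        have h3 : j ∉ I := by rw [hI, Finset.mem_Ico]; lia
        simp [jacobi, hφv, h1, h2, h3]
  have hleft : ‖φ‖ ^ 2 = ∑ j ∈ I, ‖Φ j‖ ^ 2 := by
    rw [EllTwo.norm_sq_eq_sum φ I fun j hj => by rw [hφv, if_neg hj]]
    exact Finset.sum_congr rfl fun j hj => by rw [hφv, if_pos hj]
  have hright : ‖T φ‖ ^ 2 ≤ ∑ j ∈ I, ‖jacobi a b Φ j‖ ^ 2 + 4 * (3 * (M * B)) ^ 2 := by
    rw [EllTwo.norm_sq_eq_sum (T φ) (I ∪ E) fun j hj => ?_]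
    · calc ∑ j ∈ I ∪ E, ‖T φ j‖ ^ 2
          ≤ ∑ j ∈ I ∪ E, ((if j ∈ I then ‖jacobi a b Φ j‖ ^ 2 else 0)
              + (if j ∈ E then (3 * (M * B)) ^ 2 else 0)) :=
            Finset.sum_le_sum fun j _ => by rw [hT]; exact key j
        _ = ∑ j ∈ I, ‖jacobi a b Φ j‖ ^ 2 + E.card * (3 * (M * B)) ^ 2 := by
            rw [Finset.sum_add_distrib, Finset.sum_ite_mem, Finset.sum_ite_mem,
              Finset.inter_eq_right.2 Finset.subset_union_left,
              Finset.inter_eq_right.2 Finset.subset_union_right, Finset.sum_const, nsmul_eq_mul]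
        _ ≤ _ := by
            have : (E.card : ℝ) ≤ 4 := by exact_mod_cast Finset.card_le_four
            gcongr
    · rw [Finset.mem_union, not_or] at hj
      have h := key j
      rw [if_neg hj.1, if_neg hj.2, add_zero] at h
      rw [hT]
      exact norm_eq_zero.1 (pow_eq_zero_iff two_ne_zero |>.1 (le_antisymm h (sq_nonneg _)))
  calc c ^ 2 * ∑ j ∈ I, ‖Φ j‖ ^ 2 = (c * ‖φ‖) ^ 2 := by rw [mul_pow, hleft]
    _ ≤ ‖T φ‖ ^ 2 := pow_le_pow_left₀ (by positivity) (hTc φ) 2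
    _ ≤ _ := hright

open Filter Topology ComplexConjugate in
/-- Parseval's identity in the mean, for a unimodular kernel with asymptotically orthogonal
columns. -/
lemma tendsto_average_norm_sq {K : ℤ → ℤ → ℂ} (hK : ∀ j n, ‖K j n‖ = 1)
    (hort : ∀ n n', n ≠ n' →
      ∃ C : ℝ, ∀ N : ℕ, ‖∑ j ∈ Finset.Ico (0 : ℤ) N, K j n * conj (K j n')‖ ≤ C)
    (s : Finset ℤ) (u : ℤ → ℂ) :
    Tendsto (fun N : ℕ => (∑ j ∈ Finset.Ico (0 : ℤ) N, ‖∑ n ∈ s, K j n * u n‖ ^ 2) / (N : ℝ))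
      atTop (𝓝 (∑ n ∈ s, ‖u n‖ ^ 2)) := by
  have hpair (n n' : ℤ) : Tendsto
      (fun N : ℕ => (∑ j ∈ Finset.Ico (0 : ℤ) N, K j n * conj (K j n')) / (N : ℂ)) atTop
      (𝓝 (if n = n' then 1 else 0)) := by
    split_ifs with h
    · subst h
      refine tendsto_const_nhds.congr' ?_
      filter_upwards [eventually_ne_atTop 0] with N hN
      have : (N : ℂ) ≠ 0 := by exact_mod_cast hN
      simp [Complex.mul_conj', hK, this]
    · obtain ⟨C, hC⟩ := hort n n' h
      refine squeeze_zero_norm (fun N => ?_) (tendsto_const_div_atTop_nhds_zero_nat C)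
      rw [norm_div, Complex.norm_natCast]
      gcongr
      exact hC N
  have hlim := tendsto_finsetSum s fun n _ => tendsto_finsetSum s fun n' _ =>
    (hpair n n').const_mul (u n * conj (u n'))
  have hval : ∑ n ∈ s, ∑ n' ∈ s, u n * conj (u n') * (if n = n' then 1 else 0)
      = ((∑ n ∈ s, ‖u n‖ ^ 2 : ℝ) : ℂ) := by
    push_cast
    refine Finset.sum_congr rfl fun n hn => ?_
    simp [hn, Complex.mul_conj']
  rw [hval] at hlim
  have hre := (Complex.continuous_re.tendsto _).comp hlim
  rw [Complex.ofReal_re] at hre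
  refine hre.congr fun N => ?_
  rw [Function.comp_apply, ← Complex.ofReal_re ((_ : ℝ) / _)]
  congr 1
  push_cast
  simp_rw [← Complex.mul_conj', map_sum, map_mul, Finset.sum_mul_sum, mul_div_assoc',
    ← Finset.sum_div, Finset.mul_sum]
  congr 1
  symm
  rw [Finset.sum_comm]
  refine Finset.sum_congr rfl fun n _ => ?_
  rw [Finset.sum_comm]
  refine Finset.sum_congr rfl fun j _ => Finset.sum_congr rfl fun n' _ => ?_
  ring

open Filter Topology ComplexConjugate in
/-- A unimodular kernel with asymptotically orthogonal columns which intertwines two Jacobi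
operators transfers lower bounds on finitely supported sequences. -/
lemma lower_bound_of_intertwining_of_finite {a b a' b' : ℤ → ℂ} {M c : ℝ} (ha : ∀ j, ‖a j‖ ≤ M)
    (hb : ∀ j, ‖b j‖ ≤ M) {T S : EllTwo →L[ℂ] EllTwo} (hT : ∀ φ j, T φ j = jacobi a b φ j)
    (hS : ∀ φ j, S φ j = jacobi a' b' φ j) {K : ℤ → ℤ → ℂ} (hK : ∀ j n, ‖K j n‖ = 1)
    (hort : ∀ n n', n ≠ n' →
      ∃ C : ℝ, ∀ N : ℕ, ‖∑ j ∈ Finset.Ico (0 : ℤ) N, K j n * conj (K j n')‖ ≤ C)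
    (hint : ∀ j n, jacobi a b (fun j => K j n) j = jacobi a' b' (K j) n)
    (hc : 0 ≤ c) (hTc : ∀ φ, c * ‖φ‖ ≤ ‖T φ‖) (u : EllTwo)
    (hu : (Function.support (u : ℤ → ℂ)).Finite) : c * ‖u‖ ≤ ‖S u‖ := by
  set v : ℤ → ℂ := jacobi a' b' u with hv
  have hvfin : v.support.Finite := support_jacobi_finite a' b' u hu
  set s : Finset ℤ := hu.toFinset ∪ hvfin.toFinset with hs
  have hus (n : ℤ) (hn : n ∉ s) : u n = 0 := by
    by_contra h
    exact hn (by simp [hs, h])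
  have hvs (n : ℤ) (hn : n ∉ s) : v n = 0 := by
    by_contra h
    exact hn (by simp [hs, h])
  set Φ : ℤ → ℂ := fun j => ∑ n ∈ s, K j n * u n with hΦ
  have hΦB (j : ℤ) : ‖Φ j‖ ≤ ∑ n ∈ s, ‖u n‖ :=
    (norm_sum_le _ _).trans (Finset.sum_le_sum fun n _ => by simp [hK])
  have hJ (j : ℤ) : jacobi a b Φ j = ∑ n ∈ s, K j n * v n := by
    have h1 : ∑ n ∈ s, K j n * v n = ∑' n, K j n * v n :=
      (tsum_eq_sum fun n hn => by rw [hvs n hn, mul_zero]).symm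
    have h2 : ∑' n, jacobi a' b' (K j) n * u n = ∑ n ∈ s, jacobi a' b' (K j) n * u n :=
      tsum_eq_sum fun n hn => by rw [hus n hn, mul_zero]
    rw [h1, hv, tsum_mul_jacobi a' b' (K j) u hu, h2]
    simp only [← hint]
    simp only [jacobi, hΦ, Finset.mul_sum, ← Finset.sum_add_distrib]
    exact Finset.sum_congr rfl fun n _ => by ring
  have hnu : ‖u‖ ^ 2 = ∑ n ∈ s, ‖u n‖ ^ 2 := EllTwo.norm_sq_eq_sum u s hus
  have hnv : ‖S u‖ ^ 2 = ∑ n ∈ s, ‖v n‖ ^ 2 := by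
    rw [EllTwo.norm_sq_eq_sum (S u) s fun n hn => by rw [hS]; exact hvs n hn]
    exact Finset.sum_congr rfl fun n _ => by rw [hS]
  have hle := le_of_tendsto_of_tendsto'
    ((tendsto_average_norm_sq hK hort s u).const_mul (c ^ 2))
    ((tendsto_average_norm_sq hK hort s v).add
      (tendsto_const_div_atTop_nhds_zero_nat (4 * (3 * (M * ∑ n ∈ s, ‖u n‖)) ^ 2)))
    fun N => by
      have h := sum_jacobi_lower_bound ha hb hT hc hTc hΦB N
      simp only [hJ] at h
      rw [mul_div_assoc', ← add_div]
      gcongr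
  rw [add_zero, ← hnu, ← hnv, ← mul_pow] at hle
  exact le_of_sq_le_sq hle (norm_nonneg _)

open Filter Topology ComplexConjugate in
lemma lower_bound_of_intertwining {a b a' b' : ℤ → ℂ} {M c : ℝ} (ha : ∀ j, ‖a j‖ ≤ M)
    (hb : ∀ j, ‖b j‖ ≤ M) {T S : EllTwo →L[ℂ] EllTwo} (hT : ∀ φ j, T φ j = jacobi a b φ j)
    (hS : ∀ φ j, S φ j = jacobi a' b' φ j) {K : ℤ → ℤ → ℂ} (hK : ∀ j n, ‖K j n‖ = 1)
    (hort : ∀ n n', n ≠ n' →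
      ∃ C : ℝ, ∀ N : ℕ, ‖∑ j ∈ Finset.Ico (0 : ℤ) N, K j n * conj (K j n')‖ ≤ C)
    (hint : ∀ j n, jacobi a b (fun j => K j n) j = jacobi a' b' (K j) n)
    (hc : 0 ≤ c) (hTc : ∀ φ, c * ‖φ‖ ≤ ‖T φ‖) (u : EllTwo) : c * ‖u‖ ≤ ‖S u‖ := by
  have hsum : Tendsto (fun s : Finset ℤ => ∑ i ∈ s, lp.single 2 i (u i)) atTop (𝓝 u) :=
    lp.hasSum_single (by norm_num) u
  refine le_of_tendsto_of_tendsto' (hsum.norm.const_mul c)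
    ((S.continuous.tendsto u).comp hsum).norm fun s => ?_
  refine lower_bound_of_intertwining_of_finite ha hb hT hS hK hort hint hc hTc _
    (s.finite_toSet.subset fun n hn => ?_)
  by_contra h
  refine hn ?_
  simp only [lp.coeFn_sum, Finset.sum_apply, lp.coeFn_single, Finset.sum_pi_single]
  exact if_neg h

/-- A bounded Jacobi operator with real coefficients is self-adjoint. -/
lemma isSelfAdjoint_of_jacobi {a b : ℤ → ℝ} {S : EllTwo →L[ℂ] EllTwo}
    (hS : ∀ φ j, S φ j = jacobi (fun j => a j) (fun j => b j) φ j) : IsSelfAdjoint S := by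
  rw [ContinuousLinearMap.isSelfAdjoint_iff']
  have hcol (n : ℤ) : S (lp.single 2 n 1) = lp.single 2 (n - 1) (a (n - 1) : ℂ)
      + lp.single 2 (n + 1) (a n : ℂ) + lp.single 2 n (b n : ℂ) := by
    ext j
    rw [hS]
    simp only [jacobi, lp.coeFn_add, Pi.add_apply, lp.single_apply, Pi.single_apply]
    by_cases h1 : j = n - 1
    · subst h1; simp [show n - 1 - 1 ≠ n by lia, show n - 1 ≠ n + 1 by lia]
    by_cases h2 : j = n + 1
    · subst h2; simp [show n + 1 + 1 ≠ n by lia, show n + 1 ≠ n - 1 by lia]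
    have h3 : j + 1 ≠ n := by lia
    have h4 : j - 1 ≠ n := by lia
    by_cases h5 : j = n
    · subst h5; simp [h1]
    · simp [h1, h2, h3, h4, h5]
  ext u n
  have h1 : inner ℂ (lp.single 2 n (1 : ℂ) : EllTwo) (S.adjoint u) = S.adjoint u n := by
    rw [lp.inner_single_left]; simp
  rw [← h1, ContinuousLinearMap.adjoint_inner_right, hcol, inner_add_left, inner_add_left,
    lp.inner_single_left, lp.inner_single_left, lp.inner_single_left, hS]
  simp [jacobi]
  ring

/-- A normal operator which is bounded below is invertible. -/
lemma isUnit_of_isStarNormal_of_lower_bound {E : Type*} [NormedAddCommGroup E]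
    [InnerProductSpace ℂ E] [CompleteSpace E] {R : E →L[ℂ] E} (hR : IsStarNormal R) {c : ℝ}
    (hc : 0 < c) (hRc : ∀ x, c * ‖x‖ ≤ ‖R x‖) : IsUnit R := by
  have hker : R.ker = ⊥ := by
    rw [LinearMap.ker_eq_bot']
    intro x hx
    have h := hRc x
    have hx' : R x = 0 := hx
    rw [hx', norm_zero] at h
    exact norm_le_zero_iff.1 (nonpos_of_mul_nonpos_right h hc)
  rw [ContinuousLinearMap.isUnit_iff_bijective,
    ContinuousLinearMap.bijective_iff_dense_range_and_antilipschitz]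
  refine ⟨?_, ⟨Real.toNNReal c⁻¹, R.antilipschitz_of_bound fun x => ?_⟩⟩
  · rw [Submodule.topologicalClosure_eq_top_iff, ContinuousLinearMap.IsStarNormal.orthogonal_range hR, hker]
  · rw [Real.coe_toNNReal _ (by positivity), inv_mul_eq_div, le_div_iff₀ hc, mul_comm]
    exact hRc x

/-- An invertible operator is bounded below. -/
lemma exists_lower_bound_of_isUnit {E : Type*} [NormedAddCommGroup E] [NormedSpace ℂ E]
    {R : E →L[ℂ] E} (hR : IsUnit R) : ∃ c : ℝ, 0 < c ∧ ∀ x, c * ‖x‖ ≤ ‖R x‖ := by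
  obtain ⟨U, rfl⟩ := hR
  set V : E →L[ℂ] E := ↑U⁻¹ with hV
  refine ⟨(‖V‖ + 1)⁻¹, by positivity, fun x => ?_⟩
  rw [inv_mul_le_iff₀ (by positivity)]
  have hx : V ((U : E →L[ℂ] E) x) = x := by
    rw [← mul_apply_eq_comp, hV, Units.inv_mul]; rfl
  calc ‖x‖ = ‖V ((U : E →L[ℂ] E) x)‖ := by rw [hx]
    _ ≤ ‖V‖ * ‖(U : E →L[ℂ] E) x‖ := V.le_opNorm _
    _ ≤ _ := by gcongr; linarith

open ComplexConjugate in
lemma spectrum_subset_of_intertwining {a b a' b' : ℤ → ℝ} {M : ℝ} (ha : ∀ j, |a j| ≤ M)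
    (hb : ∀ j, |b j| ≤ M) {T S : EllTwo →L[ℂ] EllTwo}
    (hT : ∀ φ j, T φ j = jacobi (fun j => a j) (fun j => b j) φ j)
    (hS : ∀ φ j, S φ j = jacobi (fun j => a' j) (fun j => b' j) φ j)
    {K : ℤ → ℤ → ℂ} (hK : ∀ j n, ‖K j n‖ = 1)
    (hort : ∀ n n', n ≠ n' →
      ∃ C : ℝ, ∀ N : ℕ, ‖∑ j ∈ Finset.Ico (0 : ℤ) N, K j n * conj (K j n')‖ ≤ C)
    (hint : ∀ j n, jacobi (fun j => a j) (fun j => b j) (fun j => K j n) j =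
      jacobi (fun j => a' j) (fun j => b' j) (K j) n) :
    spectrum ℂ S ⊆ spectrum ℂ T := by
  intro z hz
  by_contra hzT
  rw [spectrum.notMem_iff] at hzT
  refine hz ?_
  change IsUnit _
  obtain ⟨c, hc, hTc⟩ := exists_lower_bound_of_isUnit hzT
  have hshift (α β : ℤ → ℂ) (R : EllTwo →L[ℂ] EllTwo) (hR : ∀ φ j, R φ j = jacobi α β φ j)
      (φ : EllTwo) (j : ℤ) : (algebraMap ℂ (EllTwo →L[ℂ] EllTwo) z - R) φ j
        = jacobi (fun j => -α j) (fun j => z - β j) φ j := by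
    rw [sub_apply, lp.coeFn_sub, Pi.sub_apply, hR,
      ContinuousLinearMap.algebraMap_apply, lp.coeFn_smul, Pi.smul_apply, smul_eq_mul]
    unfold jacobi
    ring
  refine isUnit_of_isStarNormal_of_lower_bound ?_ hc <|
    lower_bound_of_intertwining (M := ‖z‖ + M) (fun j => ?_) (fun j => ?_) (hshift _ _ T hT)
      (hshift _ _ S hS) hK hort (fun j n => ?_) hc.le hTc
  · have hs : star S = S := isSelfAdjoint_of_jacobi hS
    refine ⟨?_⟩
    rw [star_sub, hs, Algebra.algebraMap_eq_smul_one, star_smul, star_one]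
    exact (((Commute.one_left _).smul_left _).sub_left
      (((Commute.one_right S).smul_right z).sub_right (Commute.refl S)))
  · rw [norm_neg, Complex.norm_real]
    exact (ha j).trans (le_add_of_nonneg_left (norm_nonneg z))
  · refine (norm_sub_le _ _).trans ?_
    rw [Complex.norm_real]
    exact add_le_add_right (hb j) _
  · have h := hint j n
    unfold jacobi at h ⊢
    linear_combination -h

/-- The quadratic phase `exp (iπ (α j² + β n² + 2 μ j n + γ j + δ n))`. -/
noncomputable def quadraticPhase (α β μ γ δ : ℝ) (j n : ℤ) : ℂ :=
  Complex.exp ((π * (α * j ^ 2 + β * n ^ 2 + 2 * μ * j * n + γ * j + δ * n) : ℝ) * Complex.I)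

lemma norm_quadraticPhase (α β μ γ δ : ℝ) (j n : ℤ) : ‖quadraticPhase α β μ γ δ j n‖ = 1 :=
  Complex.norm_exp_ofReal_mul_I _

lemma quadraticPhase_swap (α β μ γ δ : ℝ) (j n : ℤ) :
    quadraticPhase α β μ γ δ j n = quadraticPhase β α μ δ γ n j := by
  unfold quadraticPhase
  congr 3
  ring

lemma exp_ne_one_of_irrational {μ : ℝ} (hμ : Irrational μ) {k : ℤ} (hk : k ≠ 0) :
    Complex.exp ((2 * π * μ * k : ℝ) * Complex.I) ≠ 1 := by
  rw [Ne, Complex.exp_eq_one_iff]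
  rintro ⟨m, hm⟩
  have h1 : ((2 * π * μ * k : ℝ) : ℂ) * Complex.I = ((2 * π * m : ℝ) : ℂ) * Complex.I := by
    rw [hm]; push_cast; ring
  have h2 : 2 * π * μ * k = 2 * π * m := by
    exact_mod_cast mul_right_cancel₀ Complex.I_ne_zero h1
  have h3 : μ * k = m := by
    have : 2 * π ≠ 0 := by positivity
    exact mul_left_cancel₀ this (by linarith)
  exact (hμ.mul_intCast hk).ne_int m h3

lemma sum_Ico_intCast_eq_sum_range {E : Type*} [AddCommMonoid E] (f : ℤ → E) (N : ℕ) :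
    ∑ j ∈ Finset.Ico (0 : ℤ) N, f j = ∑ j ∈ Finset.range N, f j := by
  refine Finset.sum_nbij' Int.toNat (fun j => (j : ℤ)) ?_ ?_ ?_ ?_ ?_ <;>
    simp only [Finset.mem_Ico, Finset.mem_range]
  all_goals intros
  all_goals first | lia | (congr 1; lia)

open ComplexConjugate in
lemma quadraticPhase_asymptotically_orthogonal {μ : ℝ} (hμ : Irrational μ) (α β γ δ : ℝ)
    (n n' : ℤ) (hn : n ≠ n') : ∃ C : ℝ, ∀ N : ℕ, ‖∑ j ∈ Finset.Ico (0 : ℤ) N,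
      quadraticPhase α β μ γ δ j n * conj (quadraticPhase α β μ γ δ j n')‖ ≤ C := by
  set z : ℂ := Complex.exp ((2 * π * μ * (n - n' : ℤ) : ℝ) * Complex.I) with hz
  have hz1 : z ≠ 1 := exp_ne_one_of_irrational hμ (sub_ne_zero.2 hn)
  have hzn : ‖z‖ = 1 := Complex.norm_exp_ofReal_mul_I _
  set w : ℂ := quadraticPhase α β μ γ δ 0 n * conj (quadraticPhase α β μ γ δ 0 n') with hw
  have hwn : ‖w‖ = 1 := by simp [hw, norm_quadraticPhase]
  refine ⟨2 / ‖z - 1‖, fun N => ?_⟩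
  have hterm (j : ℕ) : quadraticPhase α β μ γ δ j n * conj (quadraticPhase α β μ γ δ j n')
      = w * z ^ j := by
    rw [hw, hz, ← Complex.exp_nat_mul]
    unfold quadraticPhase
    simp only [← Complex.exp_conj, map_mul, Complex.conj_ofReal, Complex.conj_I,
      ← Complex.exp_add]
    congr 1
    push_cast
    ring
  rw [sum_Ico_intCast_eq_sum_range, Finset.sum_congr rfl fun j _ => hterm j, ← Finset.mul_sum,
    geom_sum_eq hz1, norm_mul, norm_div, hwn, one_mul]
  gcongr
  refine (norm_sub_le _ _).trans ?_
  rw [norm_pow, hzn]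
  norm_num

lemma jacobi_quadraticPhase (μ θ ν : ℝ) (j n : ℤ) :
    jacobi (fun j => (2 * Real.cos (π * (μ * j + θ)) : ℝ)) (fun _ => (0 : ℝ))
      (fun j => quadraticPhase (-μ / 2) (-μ) μ (ν / π - θ + μ / 2) (2 * θ - ν / π - μ) j n) j =
    jacobi (fun _ => (1 : ℝ)) (fun n => (2 * Real.cos (2 * π * μ * n + ν) : ℝ))
      (quadraticPhase (-μ / 2) (-μ) μ (ν / π - θ + μ / 2) (2 * θ - ν / π - μ) j) n := by
  have hπ : (π : ℂ) ≠ 0 := by exact_mod_cast Real.pi_ne_zero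
  have h2cos (x : ℝ) : ((2 * Real.cos x : ℝ) : ℂ)
      = Complex.exp (x * Complex.I) + Complex.exp (-x * Complex.I) := by
    push_cast
    exact Complex.two_cos _
  have hsum {p₁ p₂ p₃ p₄ q₁ q₂ q₃ q₄ : ℂ} (h₁ : p₁ = q₃) (h₂ : p₂ = q₂) (h₃ : p₃ = q₁)
      (h₄ : p₄ = q₄) : p₁ + p₂ + (p₃ + p₄) = q₁ + q₂ + (q₃ + q₄) := by
    rw [h₁, h₂, h₃, h₄]
    ring
  simp only [jacobi, h2cos, quadraticPhase, Complex.ofReal_one, Complex.ofReal_zero, one_mul,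
    zero_mul, add_zero, add_mul, ← Complex.exp_add]
  apply hsum <;>
  · congr 1
    push_cast
    field_simp
    ring

/-- For irrational `μ` and any `θ, ν ∈ ℝ`, with `A_j = μ j + θ`, the
spectrum of the weighted discrete chain operator `L_A` coincides with the spectrum of
the critical almost Mathieu operator `H_{μ,ν}`. -/
theorem spectrum_chain_eq_spectrum_almost_mathieu
    (μ : ℝ) (hμ : Irrational μ) (θ ν : ℝ)
    (L H : lp (fun _ : ℤ => ℂ) 2 →L[ℂ] lp (fun _ : ℤ => ℂ) 2)
    (hL : ∀ (φ : lp (fun _ : ℤ => ℂ) 2) (j : ℤ),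
      L φ j = ((2 * Real.cos (π * (μ * j + θ)) : ℝ) : ℂ) * φ (j + 1)
        + ((2 * Real.cos (π * (μ * (j - 1) + θ)) : ℝ) : ℂ) * φ (j - 1))
    (hH : ∀ (u : lp (fun _ : ℤ => ℂ) 2) (n : ℤ),
      H u n = u (n + 1) + u (n - 1) + ((2 * Real.cos (2 * π * μ * n + ν) : ℝ) : ℂ) * u n) :
    spectrum ℂ L = spectrum ℂ H := by
  have hcos (x : ℝ) : |2 * Real.cos x| ≤ 2 := by
    rw [abs_mul, abs_two]
    linarith [Real.abs_cos_le_one x]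
  have hL' (φ : EllTwo) (j : ℤ) : L φ j =
      jacobi (fun j => (2 * Real.cos (π * (μ * j + θ)) : ℝ)) (fun _ => (0 : ℝ)) φ j := by
    rw [hL]
    simp [jacobi]
  have hH' (φ : EllTwo) (j : ℤ) : H φ j =
      jacobi (fun _ => (1 : ℝ)) (fun n => (2 * Real.cos (2 * π * μ * n + ν) : ℝ)) φ j := by
    rw [hH]
    simp [jacobi]
  refine subset_antisymm ?_ ?_
  · refine spectrum_subset_of_intertwining (M := 2) (fun _ => by norm_num) (fun _ => hcos _) hH' hL'
      (norm_quadraticPhase (-μ) (-μ / 2) μ (2 * θ - ν / π - μ) (ν / π - θ + μ / 2))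
      (quadraticPhase_asymptotically_orthogonal hμ _ _ _ _) fun n j => ?_
    have h := (jacobi_quadraticPhase μ θ ν j n).symm
    simp only [jacobi, quadraticPhase_swap (-μ / 2)] at h ⊢
    exact h
  · exact spectrum_subset_of_intertwining (M := 2) (fun _ => hcos _) (fun _ => by norm_num) hL' hH'
      (norm_quadraticPhase _ _ _ _ _) (quadraticPhase_asymptotically_orthogonal hμ _ _ _ _)
      (jacobi_quadraticPhase μ θ ν)
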